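/- arXiv:1502.03288 — 3 statements merged into one kernel-verified Lean document; each statement's English description precedes it below -/
import Mathlib

section
/- Let n and u be positive integers with n ≤ u, and let g_1, ..., g_n be positive integers with Σ_{i=1}^n g_i = u. Then 2·Σ_{i=1}^n ⌊log₂(⌊log₂ g_i⌋ + 1)⌋ ≤ 2n·log₂(log₂(u/n) + 1). -/
/-- The Jensen inequality for the base-two logarithm and uniform weights. -/
theorem sum_logb_two_le_mul_logb_average {ι : Type*} [Fintype ι] [Nonempty ι] (x : ι → ℝ)
    (hx : ∀ i, 0 < x i) :
    ∑ i, Real.logb 2 (x i) ≤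
      Fintype.card ι * Real.logb 2 ((∑ i, x i) / Fintype.card ι) := by
  have hc : (0 : ℝ) < Fintype.card ι := by exact_mod_cast Fintype.card_pos
  have h := strictConcaveOn_log_Ioi.concaveOn.le_map_sum
    (t := Finset.univ) (w := fun _ : ι => (Fintype.card ι : ℝ)⁻¹) (p := x)
    (fun _ _ => by positivity) (by simp [hc.ne']) (fun i _ => hx i)
  simp only [smul_eq_mul, ← Finset.mul_sum] at h
  rw [inv_mul_le_iff₀ hc, inv_mul_eq_div] at h
  simp only [Real.logb, ← Finset.sum_div, ← mul_div_assoc]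
  exact div_le_div_of_nonneg_right h (Real.log_nonneg one_le_two)


/-- For positive integers `n ≤ u` and positive gaps `g₁,...,gₙ` summing to `u`,
the Elias δ decoding overhead `Z_δ = 2·∑ ⌊log₂(⌊log₂ gᵢ⌋ + 1)⌋` is at most
`2n·log₂(log₂(u/n) + 1)`. -/
theorem Zdelta_le (n u : ℕ) (hn : 0 < n) (hu : 0 < u) (hnu : n ≤ u)
    (g : Fin n → ℕ) (hg : ∀ i, 0 < g i) (hsum : ∑ i, g i = u) :
    2 * (∑ i, (Nat.log 2 (Nat.log 2 (g i) + 1) : ℝ)) ≤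
      2 * n * Real.logb 2 (Real.logb 2 (u / n) + 1) := by
  have : Nonempty (Fin n) := ⟨⟨0, hn⟩⟩
  have hn' : (0 : ℝ) < n := by exact_mod_cast hn
  have hlog (i : Fin n) : 0 ≤ Real.logb 2 (g i) :=
    Real.logb_nonneg one_lt_two (by exact_mod_cast hg i)
  have hterm (i : Fin n) : (Nat.log 2 (Nat.log 2 (g i) + 1) : ℝ) ≤
      Real.logb 2 (Real.logb 2 (g i) + 1) := by
    refine (Real.natLog_le_logb _ 2).trans ?_
    have h := Real.natLog_le_logb (g i) 2
    push_cast at h ⊢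
    exact Real.logb_le_logb_of_le one_lt_two (by positivity) (by linarith)
  have hinner := sum_logb_two_le_mul_logb_average (fun i => (g i : ℝ))
    fun i => by exact_mod_cast hg i
  have houter := sum_logb_two_le_mul_logb_average (fun i => Real.logb 2 (g i) + 1)
    fun i => by linarith [hlog i]
  rw [Fintype.card_fin, ← Nat.cast_sum, hsum] at hinner
  rw [Fintype.card_fin] at houter
  have hpos : 0 < (∑ i, (Real.logb 2 (g i) + 1)) / n :=
    div_pos (Finset.sum_pos (fun i _ => by linarith [hlog i]) Finset.univ_nonempty) hn'
  have havg : (∑ i, (Real.logb 2 (g i) + 1)) / n ≤ Real.logb 2 (u / n) + 1 := by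
    rw [div_le_iff₀ hn', Finset.sum_add_distrib]
    simp only [Finset.sum_const, Finset.card_univ, Fintype.card_fin, nsmul_eq_mul, mul_one]
    linarith
  rw [mul_assoc]
  gcongr
  calc ∑ i, (Nat.log 2 (Nat.log 2 (g i) + 1) : ℝ)
      ≤ ∑ i, Real.logb 2 (Real.logb 2 (g i) + 1) := Finset.sum_le_sum fun i _ => hterm i
    _ ≤ n * Real.logb 2 ((∑ i, (Real.logb 2 (g i) + 1)) / n) := houter
    _ ≤ n * Real.logb 2 (Real.logb 2 (u / n) + 1) := by
      gcongr
      exact one_lt_two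
end

section
/- Let u and n be positive integers with n ≤ u/2, let S = {s_1 < s_2 < ... < s_n} ⊆ {0, ..., u-1} with u-1 ∈ S, and let g_1, ..., g_n be its gap sequence. Then gap(S) = Σ_{i=1}^n (⌊log₂ g_i⌋ + 1) ≤ u·H₀(S), where H₀(S) = (n/u)·log₂(u/n) + ((u-n)/u)·log₂(u/(u-n)) is the zero-order empirical entropy of the set S. -/
/-- On `[1/2, 1]` the graph of `-y log y` lies above the chord joining its endpoints. -/
theorem Real.one_sub_mul_log_two_le_negMulLog {y : ℝ} (h₁ : 1 / 2 ≤ y) (h₂ : y ≤ 1) :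
    (1 - y) * Real.log 2 ≤ Real.negMulLog y := by
  have h := Real.concaveOn_negMulLog.2
    (show (1 / 2 : ℝ) ∈ Set.Ici 0 by norm_num) (show (1 : ℝ) ∈ Set.Ici 0 by norm_num)
    (show 0 ≤ 2 * (1 - y) by linarith) (show 0 ≤ 2 * y - 1 by linarith) (by ring)
  have e : 2 * (1 - y) * (1 / 2) + (2 * y - 1) * 1 = y := by ring
  simp only [smul_eq_mul] at h
  rw [e] at h
  have h_half : Real.negMulLog (1 / 2) = 1 / 2 * Real.log 2 := by
    rw [Real.negMulLog, one_div, Real.log_inv]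
    ring
  rw [h_half, Real.negMulLog_one] at h
  linarith

/-- The logarithm version of the AM-GM inequality. -/
theorem Real.sum_log_le_card_mul_log {ι : Type*} (t : Finset ι) (x : ι → ℝ) {m : ℝ}
    (hm : 0 < m) (hx : ∀ i ∈ t, 0 < x i) (hsum : ∑ i ∈ t, x i ≤ t.card * m) :
    ∑ i ∈ t, Real.log (x i) ≤ t.card * Real.log m := by
  have h : ∀ i ∈ t, Real.log (x i) ≤ Real.log m + (x i / m - 1) := fun i hi => by
    have := Real.log_le_sub_one_of_pos (div_pos (hx i hi) hm)
    rw [Real.log_div (hx i hi).ne' hm.ne'] at this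
    linarith
  have h_div : (∑ i ∈ t, x i) / m ≤ t.card := (div_le_iff₀ hm).2 hsum
  calc ∑ i ∈ t, Real.log (x i) ≤ ∑ i ∈ t, (Real.log m + (x i / m - 1)) := Finset.sum_le_sum h
    _ = t.card * Real.log m + ((∑ i ∈ t, x i) / m - t.card) := by
      simp [Finset.sum_add_distrib, Finset.sum_sub_distrib, Finset.sum_div]
    _ ≤ t.card * Real.log m := by linarith

/-- The gaps of a strictly increasing sequence in `{0, ..., u-1}` are positive and sum to at most `u`. -/
theorem gaps_pos_and_sum_le {u n : ℕ}
    (s : Fin n → ℕ) (hmono : StrictMono s) (hlt : ∀ i, s i < u)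
    (g : Fin n → ℕ)
    (hg : ∀ i : Fin n, g i =
      (s i + 1) - (if h : i.val = 0 then 0 else s ⟨i.val - 1, by omega⟩ + 1)) :
    (∀ i, 0 < g i) ∧ ∑ i, g i ≤ u := by
  let t : ℕ → ℕ := fun k => if k = 0 then 0 else if h : k - 1 < n then s ⟨k - 1, h⟩ + 1 else 0
  have ht : ∀ i : Fin n, t i < t (i + 1) ∧ g i = t (i + 1) - t i := fun i => by
    have hs : t (i + 1) = s i + 1 := by simp [t]
    rw [hs, hg i]
    by_cases h : i.val = 0
    · simp [t, h]
    · have hi : i.val - 1 < n := by omega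
      have hp : s ⟨i.val - 1, hi⟩ < s i := hmono (Fin.mk_lt_of_lt_val (by omega))
      have hti : t i = s ⟨i.val - 1, hi⟩ + 1 := by simp only [t, if_neg h, dif_pos hi]
      rw [hti, dif_neg h]
      omega
  refine ⟨fun i => by have := ht i; omega, ?_⟩
  have hsum : ∀ k ≤ n, ∑ i ∈ Finset.range k, (t (i + 1) - t i) = t k := fun k hk => by
    induction k with
    | zero => simp [t]
    | succ k ih =>
      rw [Finset.sum_range_succ, ih (by omega)]
      have := (ht ⟨k, hk⟩).1
      simp only at this
      omega
  calc ∑ i, g i = ∑ i : Fin n, (t (i + 1) - t i) := Finset.sum_congr rfl fun i _ => (ht i).2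
    _ = ∑ i ∈ Finset.range n, (t (i + 1) - t i) :=
      Fin.sum_univ_eq_sum_range (fun i => t (i + 1) - t i) n
    _ = t n := hsum n le_rfl
    _ ≤ u := by
      simp only [t]
      split_ifs with h₀ h
      · exact Nat.zero_le _
      · exact hlt _
      · exact Nat.zero_le _

/-- For a set `S = {s₀ < s₁ < ... < s_{n-1}} ⊆ {0,...,u-1}` with `u-1 ∈ S` and
`n ≤ u/2`, the gap measure satisfies `gap(S) ≤ u·H₀(S)`, where
`H₀(S) = (n/u)·log₂(u/n) + ((u-n)/u)·log₂(u/(u-n))`. -/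
theorem gap_le_uH0 (u n : ℕ) (hn : 0 < n) (hu : 0 < u) (hhalf : 2 * n ≤ u)
    (s : Fin n → ℕ) (hmono : StrictMono s) (hlt : ∀ i, s i < u)
    (hlast : ∃ i, s i = u - 1)
    (g : Fin n → ℕ)
    (hg : ∀ i : Fin n, g i =
      (s i + 1) - (if h : i.val = 0 then 0 else s ⟨i.val - 1, by omega⟩ + 1)) :
    (∑ i, ((Nat.log 2 (g i) : ℝ) + 1)) ≤
      u * ((n / u) * Real.logb 2 (u / n) +
           ((u - n) / u) * Real.logb 2 ((u : ℝ) / ((u : ℝ) - n))) := by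
  obtain ⟨hpos, hsum⟩ := gaps_pos_and_sum_le s hmono hlt g hg
  have hnR : (0 : ℝ) < n := by exact_mod_cast hn
  have huR : (0 : ℝ) < u := by exact_mod_cast hu
  have hhR : 2 * (n : ℝ) ≤ u := by exact_mod_cast hhalf
  have hlog2 : 0 < Real.log 2 := Real.log_pos one_lt_two
  have hgap : ∑ i, Real.logb 2 (g i) ≤ n * Real.logb 2 (u / n) := by
    have h := Real.sum_log_le_card_mul_log Finset.univ (fun i => (g i : ℝ))
      (div_pos huR hnR) (fun i _ => by exact_mod_cast hpos i) (by
        rw [Finset.card_univ, Fintype.card_fin, mul_div_cancel₀ _ hnR.ne']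
        exact_mod_cast hsum)
    rw [Finset.card_univ, Fintype.card_fin] at h
    simp only [Real.logb]
    rw [← Finset.sum_div, ← mul_div_assoc]
    gcongr
  have hrest : (n : ℝ) ≤ (u - n) * Real.logb 2 ((u : ℝ) / ((u : ℝ) - n)) := by
    have h := Real.one_sub_mul_log_two_le_negMulLog (y := ((u : ℝ) - n) / u)
      (by rw [le_div_iff₀ huR]; linarith) (by rw [div_le_iff₀ huR]; linarith)
    rw [Real.negMulLog, ← inv_div (u : ℝ), Real.log_inv, inv_div] at h
    rw [Real.logb, ← mul_div_assoc, le_div_iff₀ hlog2]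
    calc (n : ℝ) * Real.log 2 = u * ((1 - ((u : ℝ) - n) / u) * Real.log 2) := by
          field_simp
          ring
      _ ≤ u * (-(((u : ℝ) - n) / u) * -Real.log (u / ((u : ℝ) - n))) := by gcongr
      _ = (u - n) * Real.log (u / ((u : ℝ) - n)) := by field_simp
  calc ∑ i, ((Nat.log 2 (g i) : ℝ) + 1) ≤ ∑ i, (Real.logb 2 (g i) + 1) := by
        gcongr with i
        exact_mod_cast Real.natLog_le_logb (g i) 2
    _ = ∑ i, Real.logb 2 (g i) + n := by simp [Finset.sum_add_distrib]
    _ ≤ n * Real.logb 2 (u / n) + (u - n) * Real.logb 2 ((u : ℝ) / ((u : ℝ) - n)) :=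
      add_le_add hgap hrest
    _ = _ := by field_simp
end

section
/- Let n and u be positive integers with n ≤ u, and let G = g_1 ... g_n be a sequence of positive integers with Σ_{i=1}^n g_i = u. Then H₀(G) ≤ log₂(u/n) + 2·log₂(log₂(u/n) + 1) + 1, where H₀(G) = -Σ_{s ∈ Σ_gap} f(s)·log₂ f(s) is the zero-order empirical entropy of G. -/
/-- A geometric distribution on the positive integers assigns mass at most `1` to a finite set. -/
theorem sum_geometric_mass_le_one {r : ℝ} (hr0 : 0 ≤ r) (hr1 : r < 1) (S : Finset ℕ)
    (hS : ∀ s ∈ S, 0 < s) : ∑ s ∈ S, (1 - r) * r ^ (s - 1) ≤ 1 := by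
  have hinj : Set.InjOn (fun s : ℕ => s - 1) S := by
    intro a ha b hb hab
    have := hS a ha
    have := hS b hb
    simp only at hab
    omega
  have hle : ∑ s ∈ S, r ^ (s - 1) ≤ (1 - r)⁻¹ := by
    rw [← Finset.sum_image (f := fun k => r ^ k) hinj, ← tsum_geometric_of_lt_one hr0 hr1]
    exact (summable_geometric_of_lt_one hr0 hr1).sum_le_tsum _ fun _ _ => pow_nonneg hr0 _
  rw [← Finset.mul_sum]
  calc (1 - r) * ∑ s ∈ S, r ^ (s - 1) ≤ (1 - r) * (1 - r)⁻¹ :=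
        mul_le_mul_of_nonneg_left hle (by linarith)
    _ = 1 := mul_inv_cancel₀ (by linarith)

/-- **Gibbs' inequality**, with a subprobability reference weight `q`. -/
theorem neg_sum_mul_log_le_neg_sum_mul_log {ι : Type*} (S : Finset ι) (f q : ι → ℝ)
    (hf : ∀ s ∈ S, 0 < f s) (hq : ∀ s ∈ S, 0 < q s) (hf1 : ∑ s ∈ S, f s = 1)
    (hq1 : ∑ s ∈ S, q s ≤ 1) :
    -∑ s ∈ S, f s * Real.log (f s) ≤ -∑ s ∈ S, f s * Real.log (q s) := by
  have h : ∑ s ∈ S, (f s * Real.log (q s) - f s * Real.log (f s)) ≤ ∑ s ∈ S, (q s - f s) := by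
    refine Finset.sum_le_sum fun s hs => ?_
    have hfs := hf s hs
    have hlog := Real.log_le_sub_one_of_pos (div_pos (hq s hs) hfs)
    rw [Real.log_div (hq s hs).ne' hfs.ne'] at hlog
    calc f s * Real.log (q s) - f s * Real.log (f s)
        = f s * (Real.log (q s) - Real.log (f s)) := by ring
      _ ≤ f s * (q s / f s - 1) := mul_le_mul_of_nonneg_left hlog hfs.le
      _ = q s - f s := by field_simp
  rw [Finset.sum_sub_distrib, Finset.sum_sub_distrib] at h
  linarith

/-- Averaging a function of the symbol against the empirical distribution of `g` amounts to
averaging over the positions. -/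
theorem sum_image_freq_mul {n : ℕ} (g : Fin n → ℕ) (F : ℕ → ℝ) :
    ∑ s ∈ Finset.image g Finset.univ,
        ((Finset.univ.filter (fun i => g i = s)).card : ℝ) / n * F s = (∑ i, F (g i)) / n := by
  rw [Finset.sum_comp F g, Finset.sum_div]
  refine Finset.sum_congr rfl fun s _ => ?_
  rw [nsmul_eq_mul]
  ring

/-- The entropy, in nats, of a sequence of positive integers is at most its cross-entropy with
a geometric distribution of ratio `r`. -/
theorem entropy_le_geometric_cross_entropy {n : ℕ} (hn : 0 < n) (g : Fin n → ℕ)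
    (hg : ∀ i, 0 < g i) {r : ℝ} (hr0 : 0 < r) (hr1 : r < 1) :
    -∑ s ∈ Finset.image g Finset.univ,
        (((Finset.univ.filter (fun i => g i = s)).card : ℝ) / n) *
          Real.log (((Finset.univ.filter (fun i => g i = s)).card : ℝ) / n) ≤
      -Real.log (1 - r) - (((∑ i, g i : ℕ) : ℝ) / n - 1) * Real.log r := by
  have hn' : (0 : ℝ) < n := by exact_mod_cast hn
  have hpos : ∀ s ∈ Finset.image g Finset.univ, 0 < s := by
    simpa using hg
  refine (neg_sum_mul_log_le_neg_sum_mul_log _ _ (fun s => (1 - r) * r ^ (s - 1)) ?_ ?_ ?_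
    (sum_geometric_mass_le_one hr0.le hr1 _ hpos)).trans_eq ?_
  · intro s hs
    obtain ⟨i, -, hi⟩ := Finset.mem_image.mp hs
    have hcard : 0 < (Finset.univ.filter (fun i => g i = s)).card :=
      Finset.card_pos.mpr ⟨i, by simpa using hi⟩
    positivity
  · intro s _
    exact mul_pos (by linarith) (pow_pos hr0 _)
  · have h := sum_image_freq_mul g fun _ => 1
    simp only [mul_one] at h
    rw [h]
    simp [hn'.ne']
  · rw [sum_image_freq_mul g fun s => Real.log ((1 - r) * r ^ (s - 1))]
    have hterm : ∀ i, Real.log ((1 - r) * r ^ (g i - 1)) =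
        (Real.log (1 - r) - Real.log r) + g i * Real.log r := by
      intro i
      rw [Real.log_mul (by linarith) (pow_pos hr0 _).ne', Real.log_pow, Nat.cast_pred (hg i)]
      ring
    simp only [hterm, Finset.sum_add_distrib, Finset.sum_const, Finset.card_univ,
      Fintype.card_fin, nsmul_eq_mul, ← Finset.sum_mul]
    push_cast
    field_simp
    ring

/-- On `[1, 2]` the concave function `logb 2` lies above its chord. -/
theorem sub_one_le_logb_two {m : ℝ} (h1 : 1 ≤ m) (h2 : m ≤ 2) : m - 1 ≤ Real.logb 2 m := by
  rw [Real.le_logb_iff_rpow_le one_lt_two (by linarith)]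
  have h := rpow_one_add_le_one_add_mul_self (s := 1) (by norm_num)
    (p := m - 1) (by linarith) (by linarith)
  norm_num at h
  exact h

/-- For positive integers `n ≤ u` and a sequence `G = g₁...gₙ` of positive integers
summing to `u`, `H₀(G) ≤ log₂(u/n) + 2·log₂(log₂(u/n) + 1) + 1`. -/
theorem H0_gaps_le_weak (n u : ℕ) (hn : 0 < n) (hu : 0 < u) (hnu : n ≤ u)
    (g : Fin n → ℕ) (hg : ∀ i, 0 < g i) (hsum : ∑ i, g i = u) :
    (-∑ s ∈ Finset.image g Finset.univ,
        (((Finset.univ.filter (fun i => g i = s)).card : ℝ) / n) *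
          Real.logb 2 (((Finset.univ.filter (fun i => g i = s)).card : ℝ) / n)) ≤
      Real.logb 2 (u / n) + 2 * Real.logb 2 (Real.logb 2 (u / n) + 1) + 1 := by
  have hn' : (0 : ℝ) < n := by exact_mod_cast hn
  have hl2 : 0 < Real.log 2 := Real.log_pos one_lt_two
  have hcross := fun {r : ℝ} => entropy_le_geometric_cross_entropy hn g hg (r := r)
  rw [hsum] at hcross
  have hm1 : (1 : ℝ) ≤ u / n := by
    rw [one_le_div hn']
    exact_mod_cast hnu
  set m : ℝ := u / n
  simp only [Real.logb.eq_1 2 (_ / (n : ℝ)), ← mul_div_assoc, ← Finset.sum_div, ← neg_div]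
  rcases le_total m 2 with hm2 | hm2
  · have hL := sub_one_le_logb_two hm1 hm2
    have hLL : 0 ≤ Real.logb 2 (Real.logb 2 m + 1) :=
      Real.logb_nonneg one_lt_two (by linarith)
    have hH := hcross (r := 2⁻¹) (by norm_num) (by norm_num)
    rw [show (1 : ℝ) - 2⁻¹ = 2⁻¹ by norm_num, Real.log_inv] at hH
    calc _ ≤ m := by
          rw [div_le_iff₀ hl2]
          linarith
      _ ≤ _ := by linarith
  · have hL : 1 ≤ Real.logb 2 m := by
      rw [Real.le_logb_iff_rpow_le one_lt_two (by linarith)]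
      simpa using hm2
    have hLL : 1 ≤ Real.logb 2 (Real.logb 2 m + 1) := by
      rw [Real.le_logb_iff_rpow_le one_lt_two (by linarith), Real.rpow_one]
      linarith
    have hm0 : 0 < m := by linarith
    have hr0 : 0 < 1 - m⁻¹ := by
      rw [sub_pos]
      exact inv_lt_one_of_one_lt₀ (by linarith)
    have hH := hcross hr0 (by linarith [inv_pos.mpr hm0])
    rw [sub_sub_cancel, Real.log_inv] at hH
    have hlog : -(m - 1) * Real.log (1 - m⁻¹) ≤ 1 := by
      have h := Real.one_sub_inv_le_log_of_pos hr0
      have hmul := mul_le_mul_of_nonneg_left h (show 0 ≤ m - 1 by linarith)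
      have heq : (m - 1) * (1 - (1 - m⁻¹)⁻¹) = -1 := by
        have : m - 1 ≠ 0 := by linarith
        rw [show 1 - m⁻¹ = (m - 1) / m by field_simp]
        field_simp
        ring
      linarith
    calc _ ≤ Real.logb 2 m + 3 := by
          rw [div_le_iff₀ hl2, add_mul, Real.logb, div_mul_cancel₀ _ hl2.ne']
          linarith [Real.log_two_gt_d9]
      _ ≤ _ := by linarith
end
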